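/- Let F = {f_1,…,f_N} be a post-critically finite IFS of bi-Lipschitz contractions on a complete metric space (X,d) with attractor K, satisfying the single intersection condition. Let x = (x_k), y = (y_k) ∈ Σ_K with x ≠ y, let ℓ = |x∧y| be the length of their maximal common prefix and I = x_1⋯x_ℓ. Suppose f_{I x_{ℓ+1}}(K) ∩ f_{I y_{ℓ+1}}(K) = {a} with a ∉ {π_K(x), π_K(y)}, and let m, n be the least integers with a ∉ f_{x_1⋯x_m}(K) and a ∉ f_{y_1⋯y_n}(K), respectively. Then x_k ∈ ∂Σ_K for every k with ℓ+2 ≤ k ≤ m−1, and y_k ∈ ∂Σ_K for every k with ℓ+2 ≤ k ≤ n−1. -/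

import Mathlib

open Set Metric
open scoped ENNReal

/-- `wordMap f [i₁,…,i_k] = f i₁ ∘ ⋯ ∘ f i_k`. -/
def wordMap {X : Type*} {ι : Type*} (f : ι → X → X) : List ι → X → X
  | [] => id
  | i :: I => f i ∘ wordMap f I

/-- The prefix word `x₁ ⋯ x_n` of an infinite word `x`. -/
def pre {ι : Type*} (x : ℕ → ι) (n : ℕ) : List ι := List.ofFn (fun j : Fin n => x j)

/-- `K` is the attractor of the IFS `f`: the (unique) nonempty compact set with
`K = ⋃ i, f i '' K`. -/
def IsAttractor {X : Type*} [MetricSpace X] {ι : Type*} (f : ι → X → X) (K : Set X) : Prop :=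
  K.Nonempty ∧ IsCompact K ∧ K = ⋃ i, f i '' K

/-- `g` is a bi-Lipschitz contraction. -/
def IsBiLipContraction {X : Type*} [MetricSpace X] (g : X → X) : Prop :=
  ∃ A B : ℝ, 0 < A ∧ B < 1 ∧ ∀ x y : X,
    A * dist x y ≤ dist (g x) (g y) ∧ dist (g x) (g y) ≤ B * dist x y

/-- `g` is a similitude of ratio `r`. -/
def IsSimilitude {X : Type*} [MetricSpace X] (g : X → X) (r : ℝ) : Prop :=
  ∀ x y : X, dist (g x) (g y) = r * dist x y

/-- The critical set `C_F = ⋃_{i ≠ j} f_i(K) ∩ f_j(K)`. -/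
def criticalSet {X : Type*} {ι : Type*} (f : ι → X → X) (K : Set X) : Set X :=
  ⋃ (i : ι) (j : ι) (_ : i ≠ j), (f i '' K) ∩ (f j '' K)

/-- The post-critical set `P_F = ⋃_{ω ∈ Σ^*} f_ω⁻¹(C_F) ∩ K`. -/
def postCriticalSet {X : Type*} {ι : Type*} (f : ι → X → X) (K : Set X) : Set X :=
  {p | p ∈ K ∧ ∃ I : List ι, I ≠ [] ∧ wordMap f I p ∈ criticalSet f K}

/-- `π` is the coding map of `(f, K)`: `{π x} = ⋂_k f_{x₁⋯x_k}(K)`. -/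
def IsCodingMap {X : Type*} {ι : Type*} (f : ι → X → X) (K : Set X)
    (π : (ℕ → ι) → X) : Prop :=
  ∀ x : ℕ → ι, (⋂ k : ℕ, wordMap f (pre x (k + 1)) '' K) = {π x}

/-- Single intersection condition: `f_i(K) ∩ f_j(K)` contains at most one point for `i ≠ j`. -/
def SIC {X : Type*} {ι : Type*} (f : ι → X → X) (K : Set X) : Prop :=
  ∀ i j : ι, i ≠ j → ((f i '' K) ∩ (f j '' K)).Subsingleton

/-- Angle separation condition with respect to a distance function `D`. -/
def ASCwrt {X : Type*} {ι : Type*} (f : ι → X → X) (K : Set X) (D : X → X → ℝ) : Prop :=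
  ∃ c : ℝ, 0 < c ∧ ∀ i j : ι, i ≠ j → ∀ z : X, (f i '' K) ∩ (f j '' K) = {z} →
    ∀ x ∈ f i '' K, ∀ y ∈ f j '' K, c * max (D x z) (D y z) ≤ D x y

/-- Angle separation condition. -/
def ASC {X : Type*} [MetricSpace X] {ι : Type*} (f : ι → X → X) (K : Set X) : Prop :=
  ASCwrt f K dist

/-- Lexicographic order on infinite words. -/
def lexLe {ι : Type*} [LinearOrder ι] (x y : ℕ → ι) : Prop :=
  x = y ∨ ∃ n : ℕ, (∀ k < n, x k = y k) ∧ x n < y n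

/-- `Σ_K`: the set of lowest codings, i.e. of words that are lexicographically least
among all words with the same image under the coding map `π`. -/
def lowestCodings {X : Type*} {ι : Type*} [LinearOrder ι] (π : (ℕ → ι) → X) :
    Set (ℕ → ι) :=
  {x | ∀ y : ℕ → ι, π y = π x → lexLe x y}

/-- `∂Σ_K`: the set of first letters of codings of post-critical points. -/
def bdryLetters {X : Type*} {ι : Type*} (f : ι → X → X) (K : Set X)
    (π : (ℕ → ι) → X) : Set ι :=
  {i | ∃ x : ℕ → ι, π x ∈ postCriticalSet f K ∧ x 0 = i}

/-- The contraction ratio `r_I = r_{i₁} ⋯ r_{i_k}` of a word. -/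
def rword {ι : Type*} (r : ι → ℝ) (I : List ι) : ℝ := (I.map r).prod

theorem wordMap_append {X ι : Type*} (f : ι → X → X) (I J : List ι) (p : X) :
    wordMap f (I ++ J) p = wordMap f I (wordMap f J p) := by
  induction I with
  | nil => rfl
  | cons i I ih => simp [wordMap, ih]

theorem pre_succ {ι : Type*} (x : ℕ → ι) (n : ℕ) : pre x (n + 1) = pre x n ++ [x n] := by
  exact (List.ofFn_succ_last (f := fun j : Fin (n + 1) => x j)).trans (by simp [pre])

theorem pre_add {ι : Type*} (x : ℕ → ι) (l k : ℕ) :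
    pre x (l + k) = pre x l ++ pre (fun i => x (l + i)) k := by
  induction k with
  | zero => simp [pre]
  | succ k ih => rw [← add_assoc, pre_succ, ih, pre_succ, List.append_assoc]

theorem pre_congr {ι : Type*} {x y : ℕ → ι} {l : ℕ} (h : ∀ j < l, x j = y j) :
    pre x l = pre y l := by
  unfold pre
  congr 1
  funext i
  exact h i i.2

theorem wordMap_pre_succ {X ι : Type*} (f : ι → X → X) (x : ℕ → ι) (n : ℕ) (p : X) :
    wordMap f (pre x (n + 1)) p = wordMap f (pre x n) (f (x n) p) := by
  rw [pre_succ, wordMap_append]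
  rfl

theorem IsBiLipContraction.injective {X : Type*} [MetricSpace X] {g : X → X}
    (hg : IsBiLipContraction g) : Function.Injective g := by
  obtain ⟨A, B, hA, -, h⟩ := hg
  intro p q hpq
  have h1 := (h p q).1
  rw [hpq, dist_self] at h1
  exact dist_le_zero.1 (nonpos_of_mul_nonpos_right h1 hA)

theorem wordMap_injective {X ι : Type*} {f : ι → X → X}
    (hf : ∀ i, Function.Injective (f i)) (I : List ι) : Function.Injective (wordMap f I) := by
  induction I with
  | nil => exact Function.injective_id
  | cons i I ih => exact (hf i).comp ih

theorem IsAttractor.map_mem {X ι : Type*} [MetricSpace X] {f : ι → X → X} {K : Set X}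
    (hK : IsAttractor f K) (i : ι) {p : X} (hp : p ∈ K) : f i p ∈ K := by
  rw [hK.2.2]
  exact mem_iUnion.2 ⟨i, p, hp, rfl⟩

theorem IsAttractor.wordMap_mem {X ι : Type*} [MetricSpace X] {f : ι → X → X} {K : Set X}
    (hK : IsAttractor f K) (I : List ι) {p : X} (hp : p ∈ K) : wordMap f I p ∈ K := by
  induction I with
  | nil => exact hp
  | cons i I ih => exact hK.map_mem i ih

/-- Every point of the cell `f i '' K` has a coding that starts with the letter `i`. -/
theorem exists_coding_of_mem_cell {X ι : Type*} [MetricSpace X] {f : ι → X → X} {K : Set X}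
    {π : (ℕ → ι) → X} (hK : IsAttractor f K) (hπ : IsCodingMap f K π) (i : ι) {b : X}
    (hb : b ∈ K) : ∃ z : ℕ → ι, π z = f i b ∧ z 0 = i := by
  have hstep : ∀ u : K, ∃ v : ι × K, f v.1 v.2 = u := by
    rintro ⟨u, hu⟩
    rw [hK.2.2] at hu
    obtain ⟨j, v, hv, rfl⟩ := mem_iUnion.1 hu
    exact ⟨(j, ⟨v, hv⟩), rfl⟩
  choose g hg using hstep
  let q : ℕ → K := fun n => (fun u => (g u).2)^[n] ⟨b, hb⟩
  have hq : ∀ n, f (g (q n)).1 (q (n + 1)) = q n := by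
    intro n
    simp only [q, Function.iterate_succ_apply']
    exact hg _
  let z : ℕ → ι := fun n => Nat.casesOn n i fun k => (g (q k)).1
  have hz : ∀ n, wordMap f (pre z (n + 1)) (q n) = f i b := by
    intro n
    induction n with
    | zero => rfl
    | succ n ih =>
      rw [wordMap_pre_succ]
      exact (congrArg _ (hq n)).trans ih
  refine ⟨z, ?_, rfl⟩
  have hmem : f i b ∈ ⋂ k : ℕ, wordMap f (pre z (k + 1)) '' K :=
    mem_iInter.2 fun k => ⟨q k, (q k).2, hz k⟩
  rw [hπ z] at hmem
  exact hmem.symm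

/-- If a point of a deeper cell of `x` also lies in a cell of a word `y` that has already
separated from `x`, then the last letter of the deeper cell is a boundary letter. -/
theorem mem_bdryLetters_of_mem_cells {X ι : Type*} [MetricSpace X] {f : ι → X → X} {K : Set X}
    {π : (ℕ → ι) → X} (hf : ∀ i, Function.Injective (f i)) (hK : IsAttractor f K)
    (hπ : IsCodingMap f K π) {x y : ℕ → ι} {l j : ℕ} (hpre : ∀ k < l, x k = y k)
    (hl : x l ≠ y l) {a : X} (hay : a ∈ wordMap f (pre y (l + 1)) '' K) (hj : l + 1 ≤ j)
    (hax : a ∈ wordMap f (pre x (j + 1)) '' K) : x j ∈ bdryLetters f K π := by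
  obtain ⟨b, hb, rfl⟩ := hax
  obtain ⟨c, hc, hcb⟩ := hay
  obtain ⟨k, rfl⟩ := Nat.exists_eq_add_of_le hj
  obtain ⟨z, hz, hz0⟩ := exists_coding_of_mem_cell hK hπ (x (l + 1 + k)) hb
  refine ⟨z, ?_, hz0⟩
  rw [hz]
  have hp := hK.map_mem (x (l + 1 + k)) hb
  refine ⟨hp, x l :: pre (fun i => x (l + 1 + i)) k, List.cons_ne_nil _ _, ?_⟩
  rw [wordMap_pre_succ, wordMap_pre_succ, pre_add, wordMap_append, wordMap_pre_succ,
    pre_congr hpre] at hcb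
  have hc' := wordMap_injective hf _ hcb
  simp only [criticalSet, mem_iUnion]
  exact ⟨x l, y l, hl, ⟨_, hK.wordMap_mem _ hp, rfl⟩, c, hc, hc'⟩

/-- **Lemma.** (Type (ii) separation prefix produces boundary letters.)
With `ℓ = |x ∧ y|`, if `f_{x₁⋯x_{ℓ+1}}(K) ∩ f_{y₁⋯y_{ℓ+1}}(K) = {a}` with
`a ∉ {π x, π y}` and `m`, `n` are least with `a ∉ f_{x₁⋯x_m}(K)`, `a ∉ f_{y₁⋯y_n}(K)`,
then the paper's letters `x_k` for `ℓ+2 ≤ k ≤ m-1` and `y_k` for `ℓ+2 ≤ k ≤ n-1` lie in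
`∂Σ_K`.  (Sequences here are 0-indexed: the paper's `x_k` is `x (k-1)`.) -/
theorem letters_in_boundary_of_type_two_separation
    {X : Type*} [MetricSpace X] [CompleteSpace X]
    {N : ℕ} (f : Fin N → X → X) (K : Set X) (π : (ℕ → Fin N) → X)
    (hf : ∀ i, IsBiLipContraction (f i))
    (hK : IsAttractor f K) (hπ : IsCodingMap f K π)
    (hpcf : (π ⁻¹' postCriticalSet f K).Finite)
    (hSIC : SIC f K)
    (x y : ℕ → Fin N) (hx : x ∈ lowestCodings π) (hy : y ∈ lowestCodings π)
    (hxy : x ≠ y)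
    (ℓ : ℕ) (hpre : ∀ j < ℓ, x j = y j) (hℓ : x ℓ ≠ y ℓ)
    (a : X)
    (ha : (wordMap f (pre x (ℓ + 1)) '' K) ∩ (wordMap f (pre y (ℓ + 1)) '' K) = {a})
    (hax : a ≠ π x) (hay : a ≠ π y)
    (m n : ℕ)
    (hm : IsLeast {t : ℕ | a ∉ wordMap f (pre x t) '' K} m)
    (hn : IsLeast {t : ℕ | a ∉ wordMap f (pre y t) '' K} n) :
    (∀ j : ℕ, ℓ + 1 ≤ j → j + 2 ≤ m → x j ∈ bdryLetters f K π) ∧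
    (∀ j : ℕ, ℓ + 1 ≤ j → j + 2 ≤ n → y j ∈ bdryLetters f K π) := by
  have hinj := fun i => (hf i).injective
  have haK : a ∈ (wordMap f (pre x (ℓ + 1)) '' K) ∩ (wordMap f (pre y (ℓ + 1)) '' K) :=
    ha ▸ mem_singleton a
  constructor
  · intro j hj hjm
    have hmem : a ∈ wordMap f (pre x (j + 1)) '' K := by
      by_contra h
      have := hm.2 h
      omega
    exact mem_bdryLetters_of_mem_cells hinj hK hπ hpre hℓ haK.2 hj hmem
  · intro j hj hjn
    have hmem : a ∈ wordMap f (pre y (j + 1)) '' K := by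
      by_contra h
      have := hn.2 h
      omega
    exact mem_bdryLetters_of_mem_cells hinj hK hπ (fun k hk => (hpre k hk).symm) hℓ.symm haK.1
      hj hmem
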